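/- For every integer r ≥ 4 there exists a constant C > 0 such that for every n divisible by r the following holds: if b > C·n^{2/(r+2)}, then Breaker has a winning strategy in the b-biased K_r-factor Maker–Breaker game played on the edge set of K_n. -/

import Mathlib

/-!
Statement 1: For every integer `r ≥ 4` there exists `C > 0` such that for every `n`
divisible by `r`: if `b > C * n^(2/(r+2))` then Breaker has a winning strategy in the
`b`-biased `K_r`-factor Maker–Breaker game played on the edge set of `K_n`.
-/

open Finset

/-- A position in a Maker–Breaker game: the board (set of available elements) and the
elements claimed so far by Maker and by Breaker. -/
structure MBPos (α : Type) where
  board : Finset α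
  maker : Finset α
  breaker : Finset α

variable {α : Type} [DecidableEq α]

/-- The elements of the board not yet claimed by either player. -/
def MBPos.unclaimed (s : MBPos α) : Finset α := s.board \ (s.maker ∪ s.breaker)

/-- Maker's move: she claims one previously unclaimed element of the board (an illegal
suggestion by her strategy is auto-corrected to an arbitrary unclaimed element).  If the
whole board has been claimed, nothing happens. -/
noncomputable def makerStep (SM : MBPos α → α) (s : MBPos α) : MBPos α :=
  if h : s.unclaimed.Nonempty then
    { s with maker := insert (if SM s ∈ s.unclaimed then SM s else h.choose) s.maker }
  else s

/-- Breaker's move: he claims `b` previously unclaimed elements of the board, or all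
remaining unclaimed elements if fewer than `b` remain (an illegal suggestion by his
strategy is auto-corrected to an arbitrary legal set of that size). -/
noncomputable def breakerStep (b : ℕ) (SB : MBPos α → Finset α) (s : MBPos α) : MBPos α :=
  { s with breaker := s.breaker ∪
      (if SB s ⊆ s.unclaimed ∧ (SB s).card = min b s.unclaimed.card then SB s
       else (Finset.exists_subset_card_eq (Nat.min_le_right b s.unclaimed.card)).choose) }

/-- One round of the `b`-biased Maker–Breaker game: Maker claims one element, then Breaker
claims `b` elements. -/
noncomputable def mbRound (b : ℕ) (SM : MBPos α → α) (SB : MBPos α → Finset α)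
    (s : MBPos α) : MBPos α :=
  breakerStep b SB (makerStep SM s)

/-- The final position of the `b`-biased Maker–Breaker game on the given board, when Maker
plays the strategy `SM` (moving first) and Breaker plays the strategy `SB`.  Since in each
round at least one board element is claimed while any remains, after `board.card` rounds the
game is over. -/
noncomputable def finalPos (b : ℕ) (board : Finset α) (SM : MBPos α → α)
    (SB : MBPos α → Finset α) : MBPos α :=
  (mbRound b SM SB)^[board.card] ⟨board, ∅, ∅⟩

/-- Maker has a winning strategy in the `b`-biased Maker–Breaker game on `board` with the
family `Wins` of winning sets: she has a strategy such that against every Breaker strategy,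
at the end of the game she has claimed all elements of some winning set. -/
noncomputable def MakerWins (b : ℕ) (board : Finset α) (Wins : Set (Finset α)) : Prop :=
  ∃ SM : MBPos α → α, ∀ SB : MBPos α → Finset α,
    ∃ W ∈ Wins, W ⊆ (finalPos b board SM SB).maker

/-- Breaker has a winning strategy: he has a strategy such that against every Maker
strategy, at the end of the game Maker has not claimed any winning set completely. -/
noncomputable def BreakerWins (b : ℕ) (board : Finset α) (Wins : Set (Finset α)) : Prop :=
  ∃ SB : MBPos α → Finset α, ∀ SM : MBPos α → α,
    ∀ W ∈ Wins, ¬ W ⊆ (finalPos b board SM SB).maker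

/-- The board of a game played on `K_n`: all edges of the complete graph on `Fin n`,
i.e. all non-diagonal unordered pairs. -/
def knBoard (n : ℕ) : Finset (Sym2 (Fin n)) :=
  Finset.univ.filter (fun e => ¬ e.IsDiag)

/-- `E` is the edge set of a `K_r`-factor of `K_n`: there is a partition of the `n` vertices
into parts of size `r` (hence `n/r` parts), and `E` consists exactly of all edges lying
inside a part, i.e. the edge sets of `n/r` pairwise vertex-disjoint copies of `K_r`. -/
def IsKrFactorEdges (n r : ℕ) (E : Finset (Sym2 (Fin n))) : Prop :=
  ∃ P : Finset (Finset (Fin n)),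
    (∀ p ∈ P, p.card = r) ∧
    (∀ p ∈ P, ∀ q ∈ P, p ≠ q → Disjoint p q) ∧
    (∀ x : Fin n, ∃ p ∈ P, x ∈ p) ∧
    (∀ e : Sym2 (Fin n), e ∈ E ↔ (¬ e.IsDiag ∧ ∃ p ∈ P, ∀ x ∈ e, x ∈ p))

theorem breakerWins_of_invariant {b : ℕ} {board : Finset α} {Wins : Set (Finset α)}
    (Inv : MBPos α → Prop) (base : Inv ⟨board, ∅, ∅⟩)
    (step : ∀ s, Inv s → ∀ e ∈ s.unclaimed,
      ∃ R ⊆ (MBPos.mk s.board (insert e s.maker) s.breaker).unclaimed,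
        R.card = min b (MBPos.mk s.board (insert e s.maker) s.breaker).unclaimed.card ∧
        Inv ⟨s.board, insert e s.maker, s.breaker ∪ R⟩)
    (final : ∀ s, Inv s → ∀ W ∈ Wins, ¬ W ⊆ s.maker) :
    BreakerWins b board Wins := by
  classical
  let Reply (s : MBPos α) (R : Finset α) : Prop :=
    R ⊆ s.unclaimed ∧ R.card = min b s.unclaimed.card ∧ Inv ⟨s.board, s.maker, s.breaker ∪ R⟩
  refine ⟨fun s => if h : ∃ R, Reply s R then h.choose else ∅, fun SM => ?_⟩
  set SB : MBPos α → Finset α := fun s => if h : ∃ R, Reply s R then h.choose else ∅ with hSB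
  have reply : ∀ s, (∃ R, Reply s R) → Inv (breakerStep b SB s) := by
    intro s h
    obtain ⟨h1, h2, h3⟩ := h.choose_spec
    have e : SB s = h.choose := by simp only [hSB, dif_pos h]
    unfold breakerStep
    rw [e, if_pos ⟨h1, h2⟩]
    exact h3
  have round : ∀ s, Inv s → Inv (mbRound b SM SB s) := by
    intro s hs
    unfold mbRound makerStep
    split_ifs with h hm
    · exact reply _ (by simpa [Reply] using step s hs _ hm)
    · exact reply _ (by simpa [Reply] using step s hs _ h.choose_spec)
    · refine reply _ ⟨∅, by simp, ?_, by simpa using hs⟩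
      rw [Finset.not_nonempty_iff_eq_empty] at h
      simp [h]
  have all : ∀ k, Inv ((mbRound b SM SB)^[k] ⟨board, ∅, ∅⟩) := by
    intro k
    induction k with
    | zero => exact base
    | succ k ih => rw [Function.iterate_succ_apply']; exact round _ ih
  exact final _ (all _)

section Potential

variable {ι : Type} (A : ι → Finset α) (q : ℝ)

/-- The weight of the `i`-th set when Maker owns `M` and Breaker owns `R`: zero if Breaker has
hit the set, and otherwise `q` to the number of elements that Maker still misses. -/
def setWeight (M R : Finset α) (i : ι) : ℝ :=
  if Disjoint (A i) R then q ^ (A i \ M).card else 0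

variable {A q} in
theorem setWeight_nonneg (hq : 0 < q) (M R : Finset α) (i : ι) : 0 ≤ setWeight A q M R i := by
  unfold setWeight; split_ifs <;> positivity

variable {A q} in
theorem setWeight_anti (hq : 0 < q) (M : Finset α) {R R' : Finset α} (h : R ⊆ R') (i : ι) :
    setWeight A q M R' i ≤ setWeight A q M R i := by
  by_cases hd : Disjoint (A i) R'
  · rw [setWeight, setWeight, if_pos hd, if_pos (hd.mono_right h)]
  · rw [setWeight, if_neg hd]; exact setWeight_nonneg hq _ _ _

variable [Fintype ι]

/-- The Erdős–Selfridge–Beck potential of a position. -/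
def potential (M R : Finset α) : ℝ := ∑ i, setWeight A q M R i

/-- The part of the potential carried by the sets containing `e`. -/
def danger (M R : Finset α) (e : α) : ℝ := ∑ i with e ∈ A i, setWeight A q M R i

variable {A q}

theorem potential_anti (hq : 0 < q) (M : Finset α) {R R' : Finset α} (h : R ⊆ R') :
    potential A q M R' ≤ potential A q M R :=
  Finset.sum_le_sum fun i _ => setWeight_anti hq M h i

theorem danger_anti (hq : 0 < q) (M : Finset α) {R R' : Finset α} (h : R ⊆ R') (e : α) :
    danger A q M R' e ≤ danger A q M R e :=
  Finset.sum_le_sum fun i _ => setWeight_anti hq M h i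

theorem potential_insert_breaker (M R : Finset α) (e : α) :
    potential A q M (insert e R) + danger A q M R e = potential A q M R := by
  unfold potential danger
  rw [Finset.sum_filter, ← Finset.sum_add_distrib]
  refine Finset.sum_congr rfl fun i _ => ?_
  by_cases h : e ∈ A i <;> simp [setWeight, h, Finset.disjoint_insert_right]

theorem potential_insert_maker (hq : 0 < q) {M : Finset α} (R : Finset α) {e : α} (he : e ∉ M) :
    potential A q (insert e M) R = potential A q M R + (q⁻¹ - 1) * danger A q M R e := by
  unfold potential danger
  rw [Finset.sum_filter, Finset.mul_sum, ← Finset.sum_add_distrib]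
  refine Finset.sum_congr rfl fun i _ => ?_
  by_cases h : e ∈ A i
  · by_cases hd : Disjoint (A i) R
    · have hc : (A i \ M).card = (A i \ insert e M).card + 1 := by
        rw [Finset.sdiff_insert, Finset.card_erase_add_one (by simp [h, he])]
      simp only [setWeight, if_pos hd, if_pos h, hc, pow_succ]
      field_simp
      ring
    · simp [setWeight, hd]
  · have hc : A i \ insert e M = A i \ M := by
      rw [Finset.sdiff_insert, Finset.erase_eq_of_notMem (by simp [h])]
    simp [setWeight, h, hc]

theorem exists_greedy_reply (hq : 0 < q) (M R U : Finset α) (c : ℕ) :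
    ∃ S ⊆ U, S.card ≤ c ∧ ∀ e ∈ U \ S,
      potential A q M (R ∪ S) + c * danger A q M (R ∪ S) e ≤ potential A q M R := by
  induction c with
  | zero => exact ⟨∅, by simp, by simp, by simp⟩
  | succ c ih =>
    obtain ⟨S, hSU, hS, h⟩ := ih
    by_cases hne : (U \ S).Nonempty
    · obtain ⟨z, hz, hmax⟩ := Finset.exists_max_image _ (danger A q M (R ∪ S)) hne
      have hz' := Finset.mem_sdiff.1 hz
      refine ⟨insert z S, Finset.insert_subset hz'.1 hSU,
        (Finset.card_insert_le _ _).trans (by omega), fun e he => ?_⟩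
      have he' : e ∈ U \ S := by
        simp only [Finset.mem_sdiff, Finset.mem_insert, not_or] at he ⊢
        exact ⟨he.1, he.2.2⟩
      have h1 := h e he'
      have h2 := hmax e he'
      have h3 := potential_insert_breaker (A := A) (q := q) M (R ∪ S) z
      have h4 := danger_anti (A := A) hq M (Finset.subset_insert z (R ∪ S)) e
      rw [Finset.union_insert]
      have h5 := mul_le_mul_of_nonneg_left h4 (Nat.cast_nonneg (α := ℝ) c)
      push_cast
      linarith
    · rw [Finset.not_nonempty_iff_eq_empty] at hne
      exact ⟨S, hSU, by omega, by simp [hne]⟩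

theorem card_claimed_le_potential (hq : 0 < q) {M R : Finset α} (hMR : Disjoint M R)
    (T : Finset ι) (hT : ∀ i ∈ T, A i ⊆ M) : (T.card : ℝ) ≤ potential A q M R := by
  calc (T.card : ℝ) = ∑ i ∈ T, setWeight A q M R i := by
        rw [Finset.card_eq_sum_ones, Nat.cast_sum]
        refine Finset.sum_congr rfl fun i hi => ?_
        simp [setWeight, hMR.mono_left (hT i hi), Finset.sdiff_eq_empty_iff_subset.2 (hT i hi)]
    _ ≤ _ := Finset.sum_le_sum_of_subset_of_nonneg (Finset.subset_univ _)
        fun i _ _ => setWeight_nonneg hq _ _ _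

theorem potential_singleton_le (hq : 0 < q) (hq1 : q ≤ 1) (e : α) :
    potential A q {e} ∅ ≤ q⁻¹ * ∑ i, q ^ (A i).card := by
  unfold potential
  rw [Finset.mul_sum]
  refine Finset.sum_le_sum fun i _ => ?_
  have h : (A i).card ≤ (A i \ {e}).card + 1 := by
    have := Finset.le_card_sdiff {e} (A i)
    simp at this
    omega
  have := pow_le_pow_of_le_one hq.le hq1 h
  rw [pow_succ] at this
  simp only [setWeight, Finset.disjoint_empty_right, if_true]
  rw [inv_mul_eq_div, le_div_iff₀ hq]
  exact this

theorem sum_pow_card_biUnion_le {Q : Type} [Fintype Q] (E : Q → Finset α)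
    {B : ℝ} (hq : 0 < q) (hB : 0 ≤ B) (Good : ℕ → Finset α → Prop)
    (hE : ∀ s S x, Good s S → Good (s + 1) (S ∪ E x)) {N : ℕ}
    (hG : ∀ s S, s < N → Good s S → ∑ x, q ^ (E x \ S).card ≤ B) (t s : ℕ) (hts : s + t ≤ N)
    (S : Finset α) (hS : Good s S) :
    ∑ g : Fin t → Q, q ^ (S ∪ Finset.univ.biUnion fun i => E (g i)).card ≤
      B ^ t * q ^ S.card := by
  induction t generalizing s S with
  | zero => simp
  | succ t ih =>
    rw [← (Fin.consEquiv fun _ => Q).sum_comp, Fintype.sum_prod_type]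
    have hU : ∀ (x : Q) (g : Fin t → Q),
        (S ∪ Finset.univ.biUnion fun i => E ((Fin.consEquiv fun _ => Q) (x, g) i)) =
          (S ∪ E x) ∪ Finset.univ.biUnion fun i => E (g i) := by
      intro x g
      ext a
      simp [Fin.exists_fin_succ]
    simp only [hU]
    calc _ ≤ ∑ x, B ^ t * q ^ (S ∪ E x).card :=
          Finset.sum_le_sum fun x _ => ih (s + 1) (by omega) _ (hE _ _ _ hS)
      _ = B ^ t * q ^ S.card * ∑ x, q ^ (E x \ S).card := by
          rw [Finset.mul_sum]
          refine Finset.sum_congr rfl fun x _ => ?_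
          rw [← Finset.union_sdiff_self_eq_union, Finset.card_union_of_disjoint
            Finset.disjoint_sdiff, pow_add, mul_assoc]
      _ ≤ B ^ t * q ^ S.card * B :=
          mul_le_mul_of_nonneg_left (hG s S (by omega) hS) (by positivity)
      _ = _ := by ring

end Potential

section Cliques

variable {V : Type} [DecidableEq V]

/-- The edges of the complete graph on the vertex set `K`. -/
def cliqueEdges (K : Finset V) : Finset (Sym2 V) := K.sym2.filter fun e => ¬ e.IsDiag

theorem mem_cliqueEdges {K : Finset V} {e : Sym2 V} :
    e ∈ cliqueEdges K ↔ (∀ x ∈ e, x ∈ K) ∧ ¬ e.IsDiag := by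
  simp [cliqueEdges, Finset.mem_sym2_iff]

theorem mk_mem_cliqueEdges {K : Finset V} {x y : V} :
    s(x, y) ∈ cliqueEdges K ↔ x ∈ K ∧ y ∈ K ∧ x ≠ y := by
  simp [mem_cliqueEdges, and_assoc]

theorem card_cliqueEdges (K : Finset V) : (cliqueEdges K).card = K.card.choose 2 := by
  rw [← Sym2.card_image_offDiag]
  congr 1
  ext ⟨x, y⟩
  simp only [mk_mem_cliqueEdges, Finset.mem_image, Finset.mem_offDiag, Prod.exists]
  constructor
  · rintro ⟨hx, hy, h⟩
    exact ⟨x, y, ⟨hx, hy, h⟩, rfl⟩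
  · rintro ⟨a, b, ⟨ha, hb, hab⟩, h⟩
    rcases Sym2.eq_iff.1 h with ⟨rfl, rfl⟩ | ⟨rfl, rfl⟩
    · exact ⟨ha, hb, hab⟩
    · exact ⟨hb, ha, hab.symm⟩

theorem cliqueEdges_mono {K S : Finset V} (h : K ⊆ S) : cliqueEdges K ⊆ cliqueEdges S :=
  fun e he => by
    rw [mem_cliqueEdges] at he ⊢
    exact ⟨fun x hx => h (he.1 x hx), he.2⟩

theorem card_new_edges {K S : Finset V} {D : Finset (Sym2 V)} (hD : D ⊆ cliqueEdges S)
    (f : Sym2 V) :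
    K.card.choose 2 - (K ∩ S).card.choose 2 - 1 ≤ ((cliqueEdges K).erase f \ D).card := by
  have h1 : (cliqueEdges K \ cliqueEdges (K ∩ S)).erase f ⊆ (cliqueEdges K).erase f \ D := by
    intro e he
    simp only [Finset.mem_erase, Finset.mem_sdiff, mem_cliqueEdges, Finset.mem_inter] at he ⊢
    refine ⟨⟨he.1, he.2.1⟩, fun h => he.2.2 ⟨fun x hx => ⟨he.2.1.1 x hx, ?_⟩, he.2.1.2⟩⟩
    exact (mem_cliqueEdges.1 (hD h)).1 x hx
  have h2 := Finset.card_le_card h1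
  have h3 := Finset.pred_card_le_card_erase (s := cliqueEdges K \ cliqueEdges (K ∩ S)) (a := f)
  have h4 := Finset.le_card_sdiff (cliqueEdges (K ∩ S)) (cliqueEdges K)
  rw [card_cliqueEdges, card_cliqueEdges] at h4
  omega

variable [Fintype V]

theorem card_extensions_le {r i : ℕ} {Z S : Finset V} (hZ : Z.card = 3) (hZS : Z ⊆ S) :
    #{K : Finset V | (K.card = r ∧ Z ⊆ K) ∧ (K ∩ S).card = i} ≤
      S.card ^ (i - 3) * Fintype.card V ^ (r - i) := by
  calc _ ≤ (S.powersetCard (i - 3) ×ˢ (Finset.univ : Finset V).powersetCard (r - i)).card := by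
        refine Finset.card_le_card_of_injOn (fun K => ((K ∩ S) \ Z, K \ S)) ?_ ?_
        · intro K hK
          simp only [Finset.coe_filter, Finset.mem_univ, true_and, Set.mem_ofPred_eq] at hK
          obtain ⟨⟨hr, hZK⟩, hi⟩ := hK
          simp only [Finset.coe_product, Set.mem_prod, Finset.mem_coe, Finset.mem_powersetCard]
          refine ⟨⟨Finset.sdiff_subset.trans Finset.inter_subset_right, ?_⟩,
            Finset.subset_univ _, ?_⟩
          · rw [Finset.card_sdiff_of_subset (Finset.subset_inter hZK hZS), hi, hZ]
          · have := Finset.card_sdiff_add_card_inter K S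
            omega
        · intro K hK K' hK' h
          simp only [Finset.coe_filter, Finset.mem_univ, true_and, Set.mem_ofPred_eq] at hK hK'
          simp only [Prod.mk.injEq, Finset.ext_iff, Finset.mem_sdiff, Finset.mem_inter] at h
          ext x
          have h1 := h.1 x
          have h2 := h.2 x
          have h3 := @hK.1.2 x
          have h4 := @hK'.1.2 x
          tauto
    _ ≤ _ := by
        rw [Finset.card_product, Finset.card_powersetCard, Finset.card_powersetCard]
        exact Nat.mul_le_mul (Nat.choose_le_pow _ _) (Nat.choose_le_pow _ _)

theorem extension_term_le {N L ε h : ℝ} (hN : 0 ≤ N) (hL : 1 ≤ L) (hε : 0 < ε) (hε1 : ε ≤ 1)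
    (hh : 1 ≤ h) {m j : ℕ} (hm : 1 ≤ m) (hNh : N ≤ ε * h ^ (m + j + 3 + 2)) :
    L ^ j * N ^ m * (h⁻¹ ^ 2) ^ ((m + j + 3).choose 2 - (j + 3).choose 2 - 1) ≤
      if j = 0 then ε * h ^ 2 else L ^ (m + j + 3) * h := by
  set e := (m + j + 3).choose 2 - (j + 3).choose 2 - 1 with he
  have hexp : m * (m + j + 3 + 2) + m * j = 2 * e + 2 := by
    have h1 : (m + j + 3).choose 2 * 2 = (m + j + 3) * (m + j + 2) := by
      rw [Nat.choose_two_right, Nat.div_mul_cancel]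
      · rfl
      · simpa [mul_comm] using (Nat.even_mul_succ_self (m + j + 2)).two_dvd
    have h2 : (j + 3).choose 2 * 2 = (j + 3) * (j + 2) := by
      rw [Nat.choose_two_right, Nat.div_mul_cancel]
      · rfl
      · simpa [mul_comm] using (Nat.even_mul_succ_self (j + 2)).two_dvd
    have h3 : (m + j + 3).choose 2 * 2 = (j + 3).choose 2 * 2 + m * (m + 2 * j + 5) := by
      rw [h1, h2]; ring
    have h4 : 1 * (1 + 2 * j + 5) ≤ m * (m + 2 * j + 5) := Nat.mul_le_mul hm (by omega)
    have h5 : m * (m + j + 3 + 2) + m * j = m * (m + 2 * j + 5) := by ring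
    omega
  have hh0 : 0 < h := by linarith
  have hpow : N ^ m ≤ ε * h ^ (m * (m + j + 3 + 2)) := by
    calc N ^ m ≤ (ε * h ^ (m + j + 3 + 2)) ^ m := pow_le_pow_left₀ hN hNh m
      _ = ε ^ m * h ^ (m * (m + j + 3 + 2)) := by rw [mul_pow, ← pow_mul, mul_comm m]
      _ ≤ ε * h ^ (m * (m + j + 3 + 2)) := by
          gcongr
          exact pow_le_of_le_one hε.le hε1 (by omega)
  have hinv : (h⁻¹ ^ 2) ^ e = (h ^ (2 * e))⁻¹ := by rw [← pow_mul, inv_pow]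
  rw [hinv, mul_inv_le_iff₀ (by positivity)]
  split_ifs with hj
  · subst hj
    rw [pow_zero, one_mul, mul_assoc, ← pow_add]
    refine hpow.trans (le_of_eq ?_)
    congr 2
    omega
  · have hmj : 1 ≤ m * j := Nat.mul_pos hm (Nat.pos_of_ne_zero hj)
    have h1 : N ^ m ≤ h * h ^ (2 * e) := by
      calc N ^ m ≤ 1 * h ^ (m * (m + j + 3 + 2)) := hpow.trans (by gcongr)
        _ ≤ h ^ (2 * e + 1) := by
            rw [one_mul]; exact pow_le_pow_right₀ hh (by omega)
        _ = _ := by ring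
    have h2 : L ^ j ≤ L ^ (m + j + 3) := pow_le_pow_right₀ hL (by omega)
    rw [mul_assoc]
    exact mul_le_mul h2 h1 (by positivity) (by positivity)

/-- The `r`-cliques through `Z`, each with a distinguished edge. -/
abbrev Threat (r : ℕ) (Z : Finset V) : Type :=
  {x : Finset V × Sym2 V // ((Z.card = 3 ∧ x.1.card = r) ∧ Z ⊆ x.1) ∧ x.2 ∈ cliqueEdges x.1}

/-- The edges of the clique of a threat other than the distinguished one. -/
def Threat.edges {r : ℕ} {Z : Finset V} (x : Threat r Z) : Finset (Sym2 V) :=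
  (cliqueEdges x.1.1).erase x.1.2

theorem sum_threats_le {r : ℕ} (hr : 4 ≤ r) {L : ℕ} (hL : 1 ≤ L) {ε h : ℝ} (hε : 0 < ε)
    (hε1 : ε ≤ 1) (hh : 1 ≤ h) (hN : (Fintype.card V : ℝ) ≤ ε * h ^ (r + 2))
    {Z S : Finset V} {D : Finset (Sym2 V)} (hZS : Z ⊆ S) (hS : S.card ≤ L)
    (hD : D ⊆ cliqueEdges S) :
    ∑ x : Threat r Z, (h⁻¹ ^ 2) ^ (x.edges \ D).card ≤
      (r : ℝ) ^ 2 * (ε * h ^ 2 + r * (L : ℝ) ^ r * h) := by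
  have hL' : (1 : ℝ) ≤ L := by exact_mod_cast hL
  by_cases hZ : Z.card = 3
  swap
  · have : IsEmpty (Threat r Z) := ⟨fun x => hZ x.2.1.1.1⟩
    rw [Finset.univ_eq_empty, Finset.sum_empty]
    positivity
  have hq0 : 0 ≤ h⁻¹ ^ 2 := by positivity
  have hq1 : h⁻¹ ^ 2 ≤ 1 := pow_le_one₀ (by positivity) (inv_le_one_of_one_le₀ hh)
  let ψ : ℕ → ℝ := fun i => (h⁻¹ ^ 2) ^ (r.choose 2 - i.choose 2 - 1)
  let 𝒦 : Finset (Finset V) := {K | K.card = r ∧ Z ⊆ K}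
  have hψ0 : ∀ i, 0 ≤ ψ i := fun i => by positivity
  have hedges : ∀ K ∈ 𝒦, ∑ f ∈ cliqueEdges K, (h⁻¹ ^ 2) ^ ((cliqueEdges K).erase f \ D).card ≤
      (r : ℝ) ^ 2 * ψ (K ∩ S).card := by
    intro K hK
    have hKr : K.card = r := (Finset.mem_filter.1 hK).2.1
    calc _ ≤ ∑ f ∈ cliqueEdges K, ψ (K ∩ S).card := by
          refine Finset.sum_le_sum fun f _ => pow_le_pow_of_le_one hq0 hq1 ?_
          rw [← hKr]
          exact card_new_edges hD f
      _ = (r.choose 2 : ℝ) * ψ (K ∩ S).card := by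
          rw [Finset.sum_const, card_cliqueEdges, hKr, nsmul_eq_mul]
      _ ≤ _ := by
          refine mul_le_mul_of_nonneg_right ?_ (hψ0 _)
          exact_mod_cast Nat.choose_le_pow r 2
  have hmaps : ∀ K ∈ 𝒦, (K ∩ S).card - 3 ∈ Finset.range (r - 3 + 1) := by
    intro K hK
    have := Finset.card_le_card (Finset.inter_subset_left (s₁ := K) (s₂ := S))
    rw [(Finset.mem_filter.1 hK).2.1] at this
    rw [Finset.mem_range]
    omega
  have hthree : ∀ K ∈ 𝒦, 3 ≤ (K ∩ S).card := fun K hK => by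
    rw [← hZ]
    exact Finset.card_le_card (Finset.subset_inter (Finset.mem_filter.1 hK).2.2 hZS)
  have hfiber : ∀ j ∈ Finset.range (r - 3 + 1),
      ∑ K ∈ 𝒦 with (K ∩ S).card - 3 = j, ψ (K ∩ S).card ≤
        if j = 0 then ε * h ^ 2 else (L : ℝ) ^ r * h := by
    intro j hj
    have hj' : j ≤ r - 3 := by rw [Finset.mem_range] at hj; omega
    have hsub : #{K ∈ 𝒦 | (K ∩ S).card - 3 = j} ≤ L ^ j * Fintype.card V ^ (r - 3 - j) := by
      have h1 := card_extensions_le (r := r) (i := j + 3) hZ hZS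
      rw [Nat.add_sub_cancel, show r - (j + 3) = r - 3 - j by omega] at h1
      refine le_trans (Finset.card_le_card ?_)
        (h1.trans (Nat.mul_le_mul_right _ (Nat.pow_le_pow_left hS j)))
      intro K hK
      rw [Finset.mem_filter] at hK
      have := hthree K hK.1
      exact Finset.mem_filter.2 ⟨Finset.mem_univ _, (Finset.mem_filter.1 hK.1).2, by omega⟩
    have hsum : ∑ K ∈ 𝒦 with (K ∩ S).card - 3 = j, ψ (K ∩ S).card ≤
        (L : ℝ) ^ j * (Fintype.card V : ℝ) ^ (r - 3 - j) * ψ (j + 3) := by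
      calc _ = ∑ K ∈ 𝒦 with (K ∩ S).card - 3 = j, ψ (j + 3) := by
            refine Finset.sum_congr rfl fun K hK => ?_
            rw [Finset.mem_filter] at hK
            have := hthree K hK.1
            rw [show (K ∩ S).card = j + 3 by omega]
        _ = (#{K ∈ 𝒦 | (K ∩ S).card - 3 = j} : ℝ) * ψ (j + 3) := by
            rw [Finset.sum_const, nsmul_eq_mul]
        _ ≤ _ := mul_le_mul_of_nonneg_right (by exact_mod_cast hsub) (hψ0 _)
    refine hsum.trans ?_
    rcases hj'.eq_or_lt with hjr | hjr
    · rw [if_neg (by omega), hjr, Nat.sub_self, pow_zero, mul_one]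
      calc (L : ℝ) ^ (r - 3) * ψ (r - 3 + 3) ≤ (L : ℝ) ^ r * 1 :=
            mul_le_mul (pow_le_pow_right₀ hL' (by omega)) (pow_le_one₀ hq0 hq1) (hψ0 _)
              (by positivity)
        _ ≤ _ := by gcongr
    · obtain ⟨m, hm⟩ : ∃ m, r = m + j + 3 := ⟨r - 3 - j, by omega⟩
      have h1 := extension_term_le (j := j) (m := m) (Nat.cast_nonneg (Fintype.card V)) hL' hε hε1
        hh (by omega) (by rw [← hm]; exact hN)
      rw [← hm] at h1
      rwa [show r - 3 - j = m by omega]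
  calc ∑ x : Threat r Z, (h⁻¹ ^ 2) ^ (x.edges \ D).card
      = ∑ K ∈ 𝒦, ∑ f ∈ cliqueEdges K, (h⁻¹ ^ 2) ^ ((cliqueEdges K).erase f \ D).card := by
        rw [Finset.sum_sigma']
        refine Finset.sum_bij' (fun x _ => ⟨x.1.1, x.1.2⟩)
          (fun y hy => ⟨(y.1, y.2), ?_⟩) ?_ ?_ ?_ ?_ ?_
        · simp only [𝒦, Finset.mem_sigma, Finset.mem_filter, Finset.mem_univ, true_and] at hy
          exact ⟨⟨⟨hZ, hy.1.1⟩, hy.1.2⟩, hy.2⟩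
        · rintro ⟨x, hx⟩ -
          simp only [𝒦, Finset.mem_sigma, Finset.mem_filter, Finset.mem_univ, true_and]
          exact ⟨⟨hx.1.1.2, hx.1.2⟩, hx.2⟩
        · simp
        · simp
        · simp
        · simp [Threat.edges]
    _ ≤ ∑ K ∈ 𝒦, (r : ℝ) ^ 2 * ψ (K ∩ S).card := Finset.sum_le_sum hedges
    _ = (r : ℝ) ^ 2 * ∑ j ∈ Finset.range (r - 3 + 1),
          ∑ K ∈ 𝒦 with (K ∩ S).card - 3 = j, ψ (K ∩ S).card := by
        rw [← Finset.mul_sum, Finset.sum_fiberwise_of_maps_to hmaps]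
    _ ≤ (r : ℝ) ^ 2 * ∑ j ∈ Finset.range (r - 3 + 1),
          (if j = 0 then ε * h ^ 2 else (L : ℝ) ^ r * h) := by
        gcongr with j hj
        exact hfiber j hj
    _ ≤ _ := by
        rw [Finset.sum_range_succ']
        simp only [Nat.add_eq_zero_iff, one_ne_zero, and_false, if_false, if_true,
          Finset.sum_const, Finset.card_range, nsmul_eq_mul]
        have h1 : ((r - 3 : ℕ) : ℝ) ≤ r := by exact_mod_cast Nat.sub_le r 3
        have h2 : ((r - 3 : ℕ) : ℝ) * ((L : ℝ) ^ r * h) ≤ r * ((L : ℝ) ^ r * h) := by gcongr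
        refine mul_le_mul_of_nonneg_left ?_ (by positivity)
        linarith

end Cliques

section Game

/-- The index set of Breaker's potential: a pair `p` of vertices together with a `t`-tuple of
threats through `v` and `p`. -/
abbrev ThreatTuple (V : Type) [DecidableEq V] (r t : ℕ) (v : V) : Type :=
  Σ p : V × V, Fin t → Threat r ({v, p.1, p.2} : Finset V)

/-- The union of the edge sets of the threats of a tuple. -/
def ThreatTuple.edges {V : Type} [DecidableEq V] {r t : ℕ} {v : V} (i : ThreatTuple V r t v) :
    Finset (Sym2 V) :=
  Finset.univ.biUnion fun j => (i.2 j).edges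

theorem sum_threatTuples_le {V : Type} [DecidableEq V] [Fintype V] {r : ℕ} (hr : 4 ≤ r)
    (t : ℕ) (v : V) {ε h : ℝ} (hε : 0 < ε) (hε1 : ε ≤ 1) (hh : 1 ≤ h)
    (hN : (Fintype.card V : ℝ) ≤ ε * h ^ (r + 2)) :
    ∑ i : ThreatTuple V r t v, (h⁻¹ ^ 2) ^ i.edges.card ≤ (Fintype.card V : ℝ) ^ 2 *
      ((r : ℝ) ^ 2 * (ε * h ^ 2 + r * ((3 + r * t : ℕ) : ℝ) ^ r * h)) ^ t := by
  rw [Fintype.sum_sigma]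
  have hp : ∀ p : V × V, ∑ g : Fin t → Threat r ({v, p.1, p.2} : Finset V),
      (h⁻¹ ^ 2) ^ (ThreatTuple.edges ⟨p, g⟩ : Finset (Sym2 V)).card ≤
        ((r : ℝ) ^ 2 * (ε * h ^ 2 + r * ((3 + r * t : ℕ) : ℝ) ^ r * h)) ^ t := by
    intro p
    let Good : ℕ → Finset (Sym2 V) → Prop := fun s S =>
      ∃ W : Finset V, {v, p.1, p.2} ⊆ W ∧ W.card ≤ 3 + r * s ∧ S ⊆ cliqueEdges W
    have hgood : ∀ s S (x : Threat r ({v, p.1, p.2} : Finset V)),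
        Good s S → Good (s + 1) (S ∪ x.edges) := by
      rintro s S x ⟨W, hZ, hc, hS⟩
      refine ⟨W ∪ x.1.1, hZ.trans Finset.subset_union_left, ?_, Finset.union_subset
        (hS.trans (cliqueEdges_mono Finset.subset_union_left))
        ((Finset.erase_subset _ _).trans (cliqueEdges_mono Finset.subset_union_right))⟩
      have h1 := Finset.card_union_le W x.1.1
      rw [x.2.1.1.2] at h1
      rw [mul_add]
      omega
    have hstep : ∀ s S, s < t → Good s S →
        ∑ x : Threat r ({v, p.1, p.2} : Finset V), (h⁻¹ ^ 2) ^ (x.edges \ S).card ≤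
          (r : ℝ) ^ 2 * (ε * h ^ 2 + r * ((3 + r * t : ℕ) : ℝ) ^ r * h) := by
      rintro s S hs ⟨W, hZ, hc, hS⟩
      have hst : r * s ≤ r * t := Nat.mul_le_mul_left _ hs.le
      exact sum_threats_le hr (by omega) hε hε1 hh hN hZ (by omega) hS
    have := sum_pow_card_biUnion_le (Threat.edges (r := r) (Z := {v, p.1, p.2}))
      (q := h⁻¹ ^ 2) (by positivity) (by positivity) Good hgood hstep t 0 (by omega) ∅
      ⟨{v, p.1, p.2}, Finset.Subset.rfl, by simpa using Finset.card_le_three, by simp⟩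
    simpa [ThreatTuple.edges] using this
  refine (Finset.sum_le_sum fun p _ => hp p).trans (le_of_eq ?_)
  rw [Finset.sum_const, Finset.card_univ, Fintype.card_prod, nsmul_eq_mul]
  push_cast
  ring

theorem card_threats_le {V : Type} [DecidableEq V] [Fintype V] {r t c : ℕ} {v x y : V}
    {q P : ℝ} (hq : 0 < q) (hP : P < ((c : ℝ) + 1) ^ t) {M R : Finset (Sym2 V)}
    (hMR : Disjoint M R)
    (hpot : potential (ThreatTuple.edges (V := V) (r := r) (t := t) (v := v)) q M R ≤ P) :
    #{z : Threat r ({v, x, y} : Finset V) | z.edges ⊆ M} ≤ c := by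
  set T : Finset (Threat r ({v, x, y} : Finset V)) := {z | z.edges ⊆ M} with hT
  let T' : Finset (ThreatTuple V r t v) :=
    (Fintype.piFinset fun _ : Fin t => T).map
      ⟨fun g => (⟨(x, y), g⟩ : ThreatTuple V r t v), fun g g' h => by simpa using h⟩
  have hcard : T'.card = T.card ^ t := by simp [T']
  have hclaimed : ∀ i ∈ T', ThreatTuple.edges i ⊆ M := by
    intro i hi
    obtain ⟨g, hg, rfl⟩ := Finset.mem_map.1 hi
    rw [Fintype.mem_piFinset] at hg
    exact Finset.biUnion_subset.2 fun j _ => (Finset.mem_filter.1 (hg j)).2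
  have h1 := card_claimed_le_potential hq hMR T' hclaimed
  rw [hcard] at h1
  push_cast at h1
  have h2 := lt_of_pow_lt_pow_left₀ t (by positivity) ((h1.trans hpot).trans_lt hP)
  have h3 : T.card < c + 1 := by exact_mod_cast h2
  omega

variable {n : ℕ}

/-- The invariant that Breaker maintains after each of his moves: the potential stays bounded
whatever edge Maker claims next, every vertex with a Maker edge avoiding `v` has its edge to `v`
claimed, and every `r`-clique through `v` is hit by Breaker or lacks two Maker edges. -/
structure BreakerInvariant (r t : ℕ) (v : Fin n) (q P : ℝ) (s : MBPos (Sym2 (Fin n))) : Prop where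
  board_eq : s.board = knBoard n
  disjoint : Disjoint s.maker s.breaker
  potential_le : ∀ e ∈ s.unclaimed,
    potential (ThreatTuple.edges (V := Fin n) (r := r) (t := t) (v := v)) q
      (insert e s.maker) s.breaker ≤ P
  star_claimed : ∀ x y, x ≠ v → y ≠ v → s(x, y) ∈ s.maker → s(v, x) ∉ s.unclaimed
  clique_safe : ∀ K : Finset (Fin n), v ∈ K → K.card = r →
    ¬ Disjoint (cliqueEdges K) s.breaker ∨ 2 ≤ (cliqueEdges K \ s.maker).card

theorem BreakerInvariant.not_subset_maker {r t : ℕ} {v : Fin n} {q P : ℝ}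
    {s : MBPos (Sym2 (Fin n))} (hs : BreakerInvariant r t v q P s) {W : Finset (Sym2 (Fin n))}
    (hW : IsKrFactorEdges n r W) : ¬ W ⊆ s.maker := by
  intro hWM
  obtain ⟨Q, hcard, -, hcover, hmem⟩ := hW
  obtain ⟨K, hK, hvK⟩ := hcover v
  have hKM : cliqueEdges K ⊆ s.maker := fun e he => by
    rw [mem_cliqueEdges] at he
    exact hWM ((hmem e).2 ⟨he.2, K, hK, he.1⟩)
  rcases hs.clique_safe K hvK (hcard K hK) with h | h
  · exact h (hs.disjoint.mono_left hKM)
  · rw [Finset.sdiff_eq_empty_iff_subset.2 hKM] at h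
    simp at h

/-- The unclaimed edges from `v` to vertices that already have a Maker edge avoiding `v`. -/
def starReply (v : Fin n) (s : MBPos (Sym2 (Fin n))) : Finset (Sym2 (Fin n)) :=
  open Classical in
  {f ∈ s.unclaimed | ∃ x y, x ≠ v ∧ y ≠ v ∧ s(x, y) ∈ s.maker ∧ f = s(v, x)}

/-- The unclaimed edges that would complete an `r`-clique of Maker through `v`. -/
def cliqueReply (r : ℕ) (v : Fin n) (s : MBPos (Sym2 (Fin n))) : Finset (Sym2 (Fin n)) :=
  open Classical in
  {f ∈ s.unclaimed | ∃ K : Finset (Fin n), v ∈ K ∧ K.card = r ∧ f ∈ cliqueEdges K ∧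
    (cliqueEdges K).erase f ⊆ s.maker}

variable {r t c b : ℕ} {v : Fin n} {q P : ℝ} {s : MBPos (Sym2 (Fin n))} {e : Sym2 (Fin n)}

theorem BreakerInvariant.card_starReply_le (hs : BreakerInvariant r t v q P s) :
    (starReply v ⟨s.board, insert e s.maker, s.breaker⟩).card ≤ 2 := by
  induction e with | _ a d
  refine (Finset.card_le_card (t := {s(v, a), s(v, d)}) ?_).trans Finset.card_le_two
  intro f hf
  simp only [starReply, Finset.mem_filter, MBPos.unclaimed] at hf
  obtain ⟨hfu, x, y, hx, hy, hxy, rfl⟩ := hf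
  rw [Finset.mem_insert] at hxy
  rcases hxy with hxy | hxy
  · rcases Sym2.eq_iff.1 hxy with ⟨rfl, rfl⟩ | ⟨rfl, rfl⟩ <;> simp
  · refine absurd ?_ (hs.star_claimed x y hx hy hxy)
    simp only [MBPos.unclaimed, Finset.mem_sdiff, Finset.mem_union, Finset.mem_insert,
      not_or] at hfu ⊢
    exact ⟨hfu.1, hfu.2.1.2, hfu.2.2⟩

theorem BreakerInvariant.mem_clique_of_mem_cliqueReply (hs : BreakerInvariant r t v q P s)
    (he : e ∈ s.unclaimed) {K : Finset (Fin n)} (hvK : v ∈ K) (hK : K.card = r)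
    {f : Sym2 (Fin n)} (hf : f ∈ (MBPos.mk s.board (insert e s.maker) s.breaker).unclaimed)
    (hfK : (cliqueEdges K).erase f ⊆ insert e s.maker) : e ∈ cliqueEdges K := by
  simp only [MBPos.unclaimed, Finset.mem_sdiff, Finset.mem_union, Finset.mem_insert,
    not_or] at hf he
  by_contra heK
  rcases hs.clique_safe K hvK hK with h | h
  · refine h (Finset.disjoint_left.2 fun g hg hgB => ?_)
    by_cases hgf : g = f
    · exact hf.2.2 (hgf ▸ hgB)
    · rcases Finset.mem_insert.1 (hfK (Finset.mem_erase.2 ⟨hgf, hg⟩)) with rfl | hgM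
      · exact heK hg
      · exact Finset.disjoint_left.1 hs.disjoint hgM hgB
  · have hsub : cliqueEdges K \ s.maker ⊆ {f} := by
      intro g hg
      rw [Finset.mem_sdiff] at hg
      by_contra hgf
      rw [Finset.mem_singleton] at hgf
      rcases Finset.mem_insert.1 (hfK (Finset.mem_erase.2 ⟨hgf, hg.1⟩)) with rfl | hgM
      · exact heK hg.1
      · exact hg.2 hgM
    have := Finset.card_le_card hsub
    simp at this
    omega

theorem BreakerInvariant.cliqueReply_eq_empty (hr : 4 ≤ r) (hs : BreakerInvariant r t v q P s)
    {x : Fin n} (he : s(v, x) ∈ s.unclaimed) :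
    cliqueReply r v ⟨s.board, insert s(v, x) s.maker, s.breaker⟩ = ∅ := by
  rw [Finset.eq_empty_iff_forall_notMem]
  intro f hf
  simp only [cliqueReply, Finset.mem_filter] at hf
  obtain ⟨hfu, K, hvK, hK, hfK, hfM⟩ := hf
  obtain ⟨-, hxK, hvx⟩ := mk_mem_cliqueEdges.1
    (hs.mem_clique_of_mem_cliqueReply he hvK hK hfu hfM)
  have hcard : 2 ≤ ((K.erase v).erase x).card := by
    rw [Finset.card_erase_of_mem (by simp [hxK, hvx.symm]), Finset.card_erase_of_mem hvK]
    omega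
  obtain ⟨y, hy, z, hz, hyz⟩ := Finset.one_lt_card.1 hcard
  simp only [Finset.mem_erase] at hy hz
  have key : ∀ w, w ≠ x → w ≠ v → w ∈ K → s(x, w) = f := by
    intro w hwx hwv hwK
    by_contra hne
    have hmem := hfM (Finset.mem_erase.2
      ⟨hne, mk_mem_cliqueEdges.2 ⟨hxK, hwK, hwx.symm⟩⟩)
    rcases Finset.mem_insert.1 hmem with h | h
    · rcases Sym2.eq_iff.1 h with ⟨h1, -⟩ | ⟨-, h1⟩
      · exact hvx h1.symm
      · exact hwv h1
    · exact hs.star_claimed x w hvx.symm hwv h he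
  have := (key y hy.1 hy.2.1 hy.2.2).trans (key z hz.1 hz.2.1 hz.2.2).symm
  exact hyz (Sym2.congr_right.1 this)

theorem BreakerInvariant.card_cliqueReply_le (hr : 4 ≤ r) (hq : 0 < q)
    (hP : P < ((c : ℝ) + 1) ^ t) (hs : BreakerInvariant r t v q P s) (he : e ∈ s.unclaimed) :
    (cliqueReply r v ⟨s.board, insert e s.maker, s.breaker⟩).card ≤ c := by
  induction e with | _ x y
  by_cases hx : x = v
  · subst hx
    rw [hs.cliqueReply_eq_empty hr he]
    simp
  by_cases hy : y = v
  · subst hy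
    rw [Sym2.eq_swap] at he ⊢
    rw [hs.cliqueReply_eq_empty hr he]
    simp
  have hxy : x ≠ y := by
    have h1 := (Finset.mem_sdiff.1 he).1
    rw [hs.board_eq] at h1
    simpa [knBoard] using h1
  have hdis : Disjoint (insert s(x, y) s.maker) s.breaker := by
    rw [Finset.disjoint_insert_left]
    refine ⟨fun h => ?_, hs.disjoint⟩
    exact (Finset.mem_sdiff.1 he).2 (Finset.mem_union_right _ h)
  refine le_trans ?_ (card_threats_le (x := x) (y := y) hq hP hdis (hs.potential_le _ he))
  refine (Finset.card_le_card ?_).trans (Finset.card_image_le (f := fun z => z.1.2))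
  intro f hf
  simp only [cliqueReply, Finset.mem_filter] at hf
  obtain ⟨hfu, K, hvK, hK, hfK, hfM⟩ := hf
  obtain ⟨hxK, hyK, -⟩ := mk_mem_cliqueEdges.1
    (hs.mem_clique_of_mem_cliqueReply he hvK hK hfu hfM)
  refine Finset.mem_image.2 ⟨⟨(K, f), ⟨⟨?_, hK⟩, ?_⟩, hfK⟩, ?_, rfl⟩
  · rw [Finset.card_eq_three]
    exact ⟨v, x, y, Ne.symm hx, Ne.symm hy, hxy, rfl⟩
  · simp [Finset.insert_subset_iff, hvK, hxK, hyK]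
  · exact Finset.mem_filter.2 ⟨Finset.mem_univ _, hfM⟩

theorem BreakerInvariant.exists_reply (hr : 4 ≤ r) (hP : P < ((c : ℝ) + 1) ^ t)
    (hb : 2 * c + 2 ≤ b) (hs : BreakerInvariant r t v ((c : ℝ) + 1)⁻¹ P s)
    (he : e ∈ s.unclaimed) :
    ∃ R ⊆ (MBPos.mk s.board (insert e s.maker) s.breaker).unclaimed,
      R.card = min b (MBPos.mk s.board (insert e s.maker) s.breaker).unclaimed.card ∧
      BreakerInvariant r t v ((c : ℝ) + 1)⁻¹ P ⟨s.board, insert e s.maker, s.breaker ∪ R⟩ := by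
  have hq : 0 < ((c : ℝ) + 1)⁻¹ := by positivity
  set s' : MBPos (Sym2 (Fin n)) := ⟨s.board, insert e s.maker, s.breaker⟩ with hs'
  obtain ⟨R₁, hR₁, hc₁, hgreedy⟩ := exists_greedy_reply
    (A := ThreatTuple.edges (V := Fin n) (r := r) (t := t) (v := v)) hq s'.maker s'.breaker
    s'.unclaimed c
  have hc₂ : (starReply v s').card ≤ 2 := hs.card_starReply_le
  have hc₃ : (cliqueReply r v s').card ≤ c := hs.card_cliqueReply_le hr hq hP he
  have hsub : R₁ ∪ (starReply v s' ∪ cliqueReply r v s') ⊆ s'.unclaimed :=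
    Finset.union_subset hR₁ (Finset.union_subset (Finset.filter_subset _ _)
      (Finset.filter_subset _ _))
  have hcard : (R₁ ∪ (starReply v s' ∪ cliqueReply r v s')).card ≤
      min b s'.unclaimed.card := by
    refine le_min ?_ (Finset.card_le_card hsub)
    have h1 := Finset.card_union_le R₁ (starReply v s' ∪ cliqueReply r v s')
    have h2 := Finset.card_union_le (starReply v s') (cliqueReply r v s')
    omega
  obtain ⟨R, hRsub, hRU, hRcard⟩ :=
    Finset.exists_subsuperset_card_eq hsub hcard (min_le_right _ _)
  have hR1 : R₁ ⊆ R := Finset.subset_union_left.trans hRsub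
  have hR2 : starReply v s' ⊆ R :=
    (Finset.subset_union_left.trans Finset.subset_union_right).trans hRsub
  have hR3 : cliqueReply r v s' ⊆ R :=
    (Finset.subset_union_right.trans Finset.subset_union_right).trans hRsub
  have heu := Finset.mem_sdiff.1 he
  rw [Finset.mem_union, not_or] at heu
  have hdis : Disjoint (insert e s.maker) s.breaker :=
    Finset.disjoint_insert_left.2 ⟨heu.2.2, hs.disjoint⟩
  have hmono : ∀ g, g ∈ (MBPos.mk s.board (insert e s.maker) (s.breaker ∪ R)).unclaimed →
      g ∈ s'.unclaimed ∧ g ∉ R := by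
    intro g hg
    simp only [hs', MBPos.unclaimed, Finset.mem_sdiff, Finset.mem_union, not_or] at hg ⊢
    tauto
  refine ⟨R, hRU, hRcard, hs.board_eq, ?_, ?_, ?_, ?_⟩
  · refine Finset.disjoint_union_right.2 ⟨hdis, Finset.disjoint_left.2 fun g hg hgR => ?_⟩
    exact (Finset.mem_sdiff.1 (hRU hgR)).2 (Finset.mem_union_left _ hg)
  · intro g hg
    obtain ⟨hgU, hgR⟩ := hmono g hg
    have hgM : g ∉ s'.maker := fun h => (Finset.mem_sdiff.1 hgU).2 (Finset.mem_union_left _ h)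
    have h1 := hgreedy g (Finset.mem_sdiff.2 ⟨hgU, fun h => hgR (hR1 h)⟩)
    have h2 := potential_anti (A := ThreatTuple.edges (V := Fin n) (r := r) (t := t) (v := v)) hq
      (insert g s'.maker) (Finset.union_subset_union_right hR1 (s := s'.breaker))
    rw [potential_insert_maker hq (s'.breaker ∪ R₁) hgM, inv_inv, add_sub_cancel_right] at h2
    exact h2.trans (h1.trans (hs.potential_le e he))
  · intro x y hx hy hxy hvx
    obtain ⟨hU, hR⟩ := hmono _ hvx
    exact hR (hR2 (Finset.mem_filter.2 ⟨hU, x, y, hx, hy, hxy, rfl⟩))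
  · intro K hvK hK
    by_contra! hcon
    obtain ⟨hKB, hlt⟩ := hcon
    rw [Finset.disjoint_union_right] at hKB
    have h2 : 2 ≤ (cliqueEdges K \ s.maker).card :=
      (hs.clique_safe K hvK hK).resolve_left (not_not.2 hKB.1)
    have h1 : (cliqueEdges K \ insert e s.maker).card = 1 := by
      have := Finset.pred_card_le_card_erase (s := cliqueEdges K \ s.maker) (a := e)
      rw [← Finset.sdiff_insert] at this
      simp only at hlt
      omega
    obtain ⟨f, hf⟩ := Finset.card_eq_one.1 h1
    have hfmem : f ∈ cliqueEdges K \ insert e s.maker := by simp [hf]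
    rw [Finset.mem_sdiff] at hfmem
    have hfU : f ∈ s'.unclaimed := by
      simp only [MBPos.unclaimed, hs', Finset.mem_sdiff, Finset.mem_union, not_or]
      refine ⟨?_, hfmem.2, Finset.disjoint_left.1 hKB.1 hfmem.1⟩
      rw [hs.board_eq]
      simpa [knBoard] using (mem_cliqueEdges.1 hfmem.1).2
    have hfR : f ∈ cliqueReply r v s' := by
      refine Finset.mem_filter.2 ⟨hfU, K, hvK, hK, hfmem.1, fun g hg => ?_⟩
      by_contra hgM
      rw [Finset.mem_erase] at hg
      have : g ∈ cliqueEdges K \ insert e s.maker := Finset.mem_sdiff.2 ⟨hg.2, hgM⟩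
      rw [hf, Finset.mem_singleton] at this
      exact hg.1 this
    exact Finset.disjoint_left.1 hKB.2 hfmem.1 (hR3 hfR)

theorem breakerWins_of_sum_le (hr : 4 ≤ r) (v : Fin n) (hb : 2 * c + 2 ≤ b)
    (hsum : ((c : ℝ) + 1) * ∑ i : ThreatTuple (Fin n) r t v,
      ((c : ℝ) + 1)⁻¹ ^ i.edges.card < ((c : ℝ) + 1) ^ t) :
    BreakerWins b (knBoard n) {E | IsKrFactorEdges n r E} := by
  refine breakerWins_of_invariant (BreakerInvariant r t v ((c : ℝ) + 1)⁻¹ _)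
    ⟨rfl, by simp, fun e _ => ?_, by simp, fun K _ hK => Or.inr ?_⟩
    (fun s hs e he => hs.exists_reply hr hsum hb he)
    (fun s hs W hW => hs.not_subset_maker hW)
  · have := potential_singleton_le (A := ThreatTuple.edges (V := Fin n) (r := r) (t := t) (v := v))
      (q := ((c : ℝ) + 1)⁻¹) (by positivity)
      (inv_le_one_of_one_le₀ (by linarith [Nat.cast_nonneg (α := ℝ) c])) e
    rw [inv_inv] at this
    simpa using this
  · rw [Finset.sdiff_empty, card_cliqueEdges, hK]
    calc 2 ≤ (4 : ℕ).choose 2 := by decide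
      _ ≤ r.choose 2 := Nat.choose_le_choose 2 hr

end Game

theorem exists_forall_polylog_le_sqrt (r : ℕ) : ∃ c₀ : ℕ, ∀ c : ℕ, c₀ ≤ c →
    4 * (r : ℝ) ^ 3 * ((3 + r * ((r + 3) * (Nat.log 2 (c + 1) + 1)) : ℕ) : ℝ) ^ r ≤
      √((c : ℝ) + 1) := by
  set K : ℝ := 4 * (r : ℝ) ^ 3 * (3 + r * (r + 3) : ℝ) ^ r with hK
  have hK0 : 0 ≤ K := by positivity
  have hs1 : 1 < √(2 : ℝ) := by
    rw [Real.lt_sqrt (by norm_num)]; norm_num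
  have htend := (tendsto_pow_const_div_const_pow_of_one_lt r hs1).comp
    (Filter.tendsto_add_atTop_nat 1)
  have hδ : 0 < (1 / ((K + 1) * √2) : ℝ) := by positivity
  obtain ⟨l₁, hl₁⟩ := Filter.eventually_atTop.1 (htend.eventually (gt_mem_nhds hδ))
  refine ⟨2 ^ l₁, fun c hc => ?_⟩
  set l := Nat.log 2 (c + 1) with hl
  have hle : l₁ ≤ l := by
    rw [hl]
    exact Nat.le_log_of_pow_le (by norm_num) (by omega)
  have h1 := hl₁ l hle
  simp only [Function.comp] at h1
  rw [div_lt_div_iff₀ (by positivity) (by positivity), one_mul, pow_succ] at h1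
  have h2 : ((l + 1 : ℕ) : ℝ) ^ r * (K + 1) < √2 ^ l := by
    have : ((l + 1 : ℕ) : ℝ) ^ r * (K + 1) * √2 < √2 ^ l * √2 := by linarith
    exact lt_of_mul_lt_mul_right this (by positivity)
  have h3 : √(2 : ℝ) ^ l ≤ √((c : ℝ) + 1) := by
    apply Real.le_sqrt_of_sq_le
    rw [← pow_mul, mul_comm, pow_mul, Real.sq_sqrt (by norm_num)]
    exact_mod_cast Nat.pow_log_le_self 2 (Nat.succ_ne_zero c)
  have h4 : ((3 + r * ((r + 3) * (l + 1)) : ℕ) : ℝ) ≤ (3 + r * (r + 3)) * ((l + 1 : ℕ) : ℝ) := by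
    push_cast
    nlinarith [Nat.cast_nonneg (α := ℝ) l]
  calc 4 * (r : ℝ) ^ 3 * ((3 + r * ((r + 3) * (l + 1)) : ℕ) : ℝ) ^ r
      ≤ 4 * (r : ℝ) ^ 3 * ((3 + r * (r + 3)) * ((l + 1 : ℕ) : ℝ)) ^ r := by gcongr
    _ = ((l + 1 : ℕ) : ℝ) ^ r * K := by rw [mul_pow, hK]; ring
    _ ≤ ((l + 1 : ℕ) : ℝ) ^ r * (K + 1) := by gcongr; linarith
    _ ≤ _ := h2.le.trans h3

theorem breakerWins_of_card_le {n r c b : ℕ} (hr : 4 ≤ r) (v : Fin n) (hb : 2 * c + 2 ≤ b)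
    (hc : 4 * (r : ℝ) ^ 3 * ((3 + r * ((r + 3) * (Nat.log 2 (c + 1) + 1)) : ℕ) : ℝ) ^ r ≤
      √((c : ℝ) + 1))
    (hn : (n : ℝ) ≤ 1 / (4 * (r : ℝ) ^ 2) * √((c : ℝ) + 1) ^ (r + 2)) :
    BreakerWins b (knBoard n) {E | IsKrFactorEdges n r E} := by
  set h := √((c : ℝ) + 1) with hh
  set l := Nat.log 2 (c + 1) + 1 with hl
  have hr' : (4 : ℝ) ≤ r := by exact_mod_cast hr
  have hsq : h ^ 2 = (c : ℝ) + 1 := Real.sq_sqrt (by positivity)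
  have h1 : 1 ≤ h := by
    rw [hh, Real.one_le_sqrt]; linarith [Nat.cast_nonneg (α := ℝ) c]
  have hε1 : 1 / (4 * (r : ℝ) ^ 2) ≤ 1 := by
    rw [div_le_one (by positivity)]; nlinarith
  have hsum := sum_threatTuples_le hr ((r + 3) * l) v (ε := 1 / (4 * (r : ℝ) ^ 2)) (h := h)
    (by positivity) hε1 h1 (by simpa using hn)
  rw [Fintype.card_fin] at hsum
  refine breakerWins_of_sum_le (t := (r + 3) * l) hr v hb ?_
  rw [← hsq, ← inv_pow]
  set Y : ℝ := ((3 + r * ((r + 3) * l) : ℕ) : ℝ) ^ r with hY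
  have hY0 : 0 ≤ Y := by positivity
  have hB : (r : ℝ) ^ 2 * (1 / (4 * (r : ℝ) ^ 2) * h ^ 2 + r * Y * h) ≤ h ^ 2 / 2 := by
    have e1 : (r : ℝ) ^ 2 * (1 / (4 * (r : ℝ) ^ 2) * h ^ 2 + r * Y * h) =
        h ^ 2 / 4 + (4 * (r : ℝ) ^ 3 * Y) * h / 4 := by
      field_simp
    have e2 : (4 * (r : ℝ) ^ 3 * Y) * h ≤ h * h := by gcongr
    rw [e1]
    nlinarith
  have hn2 : (n : ℝ) ≤ h ^ (r + 2) :=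
    hn.trans (mul_le_of_le_one_left (by positivity) hε1)
  have hlog : h ^ 2 * (n : ℝ) ^ 2 < 2 ^ ((r + 3) * l) := by
    have h2 : h ^ 2 < 2 ^ l := by
      rw [hsq]
      exact_mod_cast Nat.lt_pow_succ_log_self (by norm_num : 1 < 2) (c + 1)
    calc h ^ 2 * (n : ℝ) ^ 2 ≤ h ^ 2 * (h ^ (r + 2)) ^ 2 := by gcongr
      _ = (h ^ 2) ^ (r + 3) := by ring
      _ < (2 ^ l) ^ (r + 3) := pow_lt_pow_left₀ h2 (by positivity) (by omega)
      _ = _ := by rw [← pow_mul, mul_comm]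
  calc _ ≤ h ^ 2 * ((n : ℝ) ^ 2 * (h ^ 2 / 2) ^ ((r + 3) * l)) := by
        gcongr
        exact hsum.trans (by gcongr)
    _ = (h ^ 2 * (n : ℝ) ^ 2) * (h ^ 2 / 2) ^ ((r + 3) * l) := by ring
    _ < 2 ^ ((r + 3) * l) * (h ^ 2 / 2) ^ ((r + 3) * l) := by gcongr
    _ = (h ^ 2) ^ ((r + 3) * l) := by
        rw [← mul_pow]; congr 1; ring

theorem statement_1 :
    ∀ r : ℕ, 4 ≤ r →
      ∃ C : ℝ, 0 < C ∧
        ∀ n : ℕ, r ∣ n →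
          ∀ b : ℕ, C * (n : ℝ) ^ ((2 : ℝ) / ((r : ℝ) + 2)) < (b : ℝ) →
            BreakerWins b (knBoard n) {E | IsKrFactorEdges n r E} := by
  intro r hr
  obtain ⟨c₀, hc₀⟩ := exists_forall_polylog_le_sqrt r
  refine ⟨3 * (c₀ + (4 * (r : ℝ) ^ 2) ^ 2 + 2), by positivity, fun n _ b hb => ?_⟩
  rcases Nat.eq_zero_or_pos n with rfl | hn
  · exact ⟨fun _ => ∅, fun SM => ((SM ⟨∅, ∅, ∅⟩).ind fun x _ => x.elim0)⟩
  have hn1 : (1 : ℝ) ≤ n := by exact_mod_cast hn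
  set y : ℝ := (n : ℝ) ^ ((1 : ℝ) / ((r : ℝ) + 2)) with hy
  have hy1 : 1 ≤ y := Real.one_le_rpow hn1 (by positivity)
  have hy2 : (n : ℝ) ^ ((2 : ℝ) / ((r : ℝ) + 2)) = y ^ 2 := by
    rw [hy, ← Real.rpow_natCast, ← Real.rpow_mul (by positivity)]
    congr 1
    push_cast
    ring
  have hyn : y ^ (r + 2) = n := by
    rw [hy, ← Real.rpow_natCast, ← Real.rpow_mul (by positivity)]
    have : (1 : ℝ) / ((r : ℝ) + 2) * ((r + 2 : ℕ) : ℝ) = 1 := by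
      push_cast
      field_simp
    rw [this, Real.rpow_one]
  rw [hy2] at hb
  set D : ℝ := 4 * (r : ℝ) ^ 2 with hD
  have hr' : (4 : ℝ) ≤ r := by exact_mod_cast hr
  have hD1 : 1 ≤ D := by rw [hD]; nlinarith
  have hb3 : (b : ℝ) < 3 * (((b / 3 : ℕ) : ℝ) + 1) := by
    have : b < 3 * (b / 3 + 1) := by omega
    exact_mod_cast this
  have hc : (c₀ + D ^ 2 + 2) * y ^ 2 < ((b / 3 : ℕ) : ℝ) + 1 := by linarith
  have hyy : 1 ≤ y ^ 2 := one_le_pow₀ hy1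
  have hcc : c₀ + D ^ 2 + 2 < ((b / 3 : ℕ) : ℝ) + 1 :=
    lt_of_le_of_lt (le_mul_of_one_le_right (by positivity) hyy) hc
  have hcc' : c₀ + 2 < b / 3 + 1 := by
    have : (c₀ : ℝ) + 2 < ((b / 3 : ℕ) : ℝ) + 1 := by nlinarith
    exact_mod_cast this
  refine breakerWins_of_card_le (c := b / 3) hr ⟨0, hn⟩ (by omega) (hc₀ _ (by omega)) ?_
  have hDy : D * y ≤ √(((b / 3 : ℕ) : ℝ) + 1) := by
    apply Real.le_sqrt_of_sq_le
    rw [mul_pow]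
    refine le_trans ?_ hc.le
    gcongr
    linarith [Nat.cast_nonneg (α := ℝ) c₀]
  rw [one_div, ← div_eq_inv_mul, le_div_iff₀ (by positivity), ← hyn]
  calc y ^ (r + 2) * D ≤ y ^ (r + 2) * D ^ (r + 2) := by
        gcongr
        exact le_self_pow₀ hD1 (by omega)
    _ = (D * y) ^ (r + 2) := by rw [mul_comm, ← mul_pow]
    _ ≤ _ := by gcongr
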